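/- Let K be a field and λ ∈ K with λ ≠ 1. Then the representation M(λ) of the cube poset {0,1}³ is not isomorphic to the interval representation V_I for any interval I of {0,1}³. In particular, over the equioriented commutative 3D grid there exist thin indecomposable representations not isomorphic to any interval representation. -/

import Mathlib

open Classical

structure PRep (K : Type) [Field K] (P : Type) [PartialOrder P] : Type 1 where
  V : P → Type
  [isAddCommGroup : ∀ x, AddCommGroup (V x)]
  [isModule : ∀ x, Module K (V x)]
  [isFinite : ∀ x, Module.Finite K (V x)]
  map : ∀ {x y : P}, x ≤ y → (V x →ₗ[K] V y)
  map_refl : ∀ x : P, map (le_refl x) = LinearMap.id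
  map_trans : ∀ {x y z : P} (hxy : x ≤ y) (hyz : y ≤ z),
    map (le_trans hxy hyz) = (map hyz).comp (map hxy)

attribute [instance] PRep.isAddCommGroup PRep.isModule PRep.isFinite

variable {K : Type} [Field K] {P : Type} [PartialOrder P]

namespace PRep

/-- Isomorphism of representations. -/
def Iso (M N : PRep K P) : Prop :=
  ∃ e : ∀ x : P, M.V x ≃ₗ[K] N.V x,
    ∀ (x y : P) (h : x ≤ y),
      (N.map h).comp (e x : M.V x →ₗ[K] N.V x)
        = (e y : M.V y →ₗ[K] N.V y).comp (M.map h)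

/-- Pointwise direct sum of two representations. -/
def dsum (M N : PRep K P) : PRep K P where
  V x := M.V x × N.V x
  map h := (M.map h).prodMap (N.map h)
  map_refl x := by
    apply LinearMap.ext; intro v
    simp [M.map_refl, N.map_refl]
  map_trans hxy hyz := by
    apply LinearMap.ext; intro v
    simp [M.map_trans hxy hyz, N.map_trans hxy hyz]

def IsThin (M : PRep K P) : Prop := ∀ x : P, Module.finrank K (M.V x) ≤ 1

def supp (M : PRep K P) : Set P := {x : P | Nontrivial (M.V x)}

def Indecomposable (M : PRep K P) : Prop :=
  (∃ x : P, Nontrivial (M.V x)) ∧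
  ∀ N₁ N₂ : PRep K P, M.Iso (N₁.dsum N₂) →
    (∀ x : P, Subsingleton (N₁.V x)) ∨ (∀ x : P, Subsingleton (N₂.V x))

end PRep

/-- Convexity of a subset of a poset. -/
def IsConvexSet (I : Set P) : Prop :=
  ∀ ⦃a b c : P⦄, a ∈ I → c ∈ I → a ≤ b → b ≤ c → b ∈ I

/-- Connectedness of a subset of a poset. -/
def IsConnectedSet (I : Set P) : Prop :=
  ∀ a ∈ I, ∀ b ∈ I,
    Relation.ReflTransGen (fun u v : P => u ∈ I ∧ v ∈ I ∧ (u ≤ v ∨ v ≤ u)) a b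

/-- An interval of a poset: nonempty, convex and connected subset. -/
def IsIntervalSet (I : Set P) : Prop :=
  I.Nonempty ∧ IsConvexSet I ∧ IsConnectedSet I

/-- The interval representation associated to a convex subset `I`. -/
noncomputable def intervalRep (K : Type) [Field K] {P : Type} [PartialOrder P]
    (I : Set P) (hI : IsConvexSet I) : PRep K P where
  V x := ↥(if x ∈ I then (⊤ : Submodule K K) else ⊥)
  map {x y} h :=
    { toFun := fun v => ⟨if y ∈ I then (v : K) else 0, by
        by_cases hy : y ∈ I
        · simp [hy]
        · simp only [if_neg hy]
          exact Submodule.zero_mem _⟩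
      map_add' := fun v w => by
        apply Subtype.ext
        by_cases hy : y ∈ I <;> simp [hy]
      map_smul' := fun c v => by
        apply Subtype.ext
        by_cases hy : y ∈ I <;> simp [hy] }
  map_refl x := by
    apply LinearMap.ext; intro v
    apply Subtype.ext
    by_cases hx : x ∈ I
    · simp [hx]
    · have hv0 : (v : K) = 0 := (Submodule.mem_bot K).1 ((SetLike.ext_iff.1 (if_neg hx) (v : K)).1 v.2)
      exact (if_neg hx).trans hv0.symm
  map_trans {x y z} hxy hyz := by
    apply LinearMap.ext; intro v
    apply Subtype.ext
    by_cases hz : z ∈ I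
    · by_cases hy : y ∈ I
      · exact congrArg (fun a : K => if z ∈ I then a else 0) (if_pos hy).symm
      · by_cases hx : x ∈ I
        · exact absurd (hI hx hz hxy hyz) hy
        · have hv0 : (v : K) = 0 := (Submodule.mem_bot K).1 ((SetLike.ext_iff.1 (if_neg hx) (v : K)).1 v.2)
          simp [hz, hy, hv0]
    · simp [hz]

namespace PRep

def IsPreInterval (M : PRep K P) : Prop :=
  M.IsThin ∧ IsIntervalSet M.supp ∧
    ∀ (x y : P) (h : x ≤ y), x ∈ M.supp → y ∈ M.supp → M.map h ≠ 0

end PRep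

/-- The cube poset `{0,1}³` with the componentwise order. -/
abbrev Cube : Type := Fin 2 × Fin 2 × Fin 2

def cubeBot : Cube := (0, 0, 0)
def cubeTop : Cube := (1, 1, 1)
def cubeA : Cube := (0, 0, 1)
def cubeB : Cube := (0, 1, 1)

/-- Scalar coefficient of the structure map of `M(λ)` from `x` to `y`:
zero into/out of the two zero vertices, `λ` on the covering relation
`(0,0,1) ≤ (0,1,1)`, and `1` otherwise. -/
noncomputable def cubeCoef {K : Type} [Field K] (lam : K) (x y : Cube) : K :=
  if x = cubeBot ∨ x = cubeTop ∨ y = cubeBot ∨ y = cubeTop then 0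
  else if x = cubeA ∧ y = cubeB then lam else 1

lemma cubeCoef_self {K : Type} [Field K] (lam : K) (x : Cube)
    (hx : ¬(x = cubeBot ∨ x = cubeTop)) : cubeCoef lam x x = 1 := by
  unfold cubeCoef
  rw [if_neg (by tauto), if_neg]
  rintro ⟨h1, h2⟩
  rw [h1] at h2
  exact absurd h2 (by decide)

lemma cubeCoef_zero_right {K : Type} [Field K] (lam : K) (x y : Cube)
    (hy : y = cubeBot ∨ y = cubeTop) : cubeCoef lam x y = 0 := by
  unfold cubeCoef
  rw [if_pos (by tauto)]

lemma cube_le_bot : ∀ x : Cube, x ≤ cubeBot → x = cubeBot := by decide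

lemma cube_top_le : ∀ z : Cube, cubeTop ≤ z → z = cubeTop := by decide

lemma cube_mid_between : ∀ x y z : Cube, x ≤ y → y ≤ z →
    ¬(x = cubeBot ∨ x = cubeTop) → ¬(y = cubeBot ∨ y = cubeTop) →
    ¬(z = cubeBot ∨ z = cubeTop) → y = x ∨ y = z := by decide

/-- The representation `M(λ)` of the cube poset. -/
noncomputable def cubeRep (K : Type) [Field K] (lam : K) : PRep K Cube where
  V v := ↥(if v = cubeBot ∨ v = cubeTop then (⊥ : Submodule K K) else ⊤)
  map {x y} h :=
    { toFun := fun v => ⟨cubeCoef lam x y * (v : K), by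
        by_cases hy : y = cubeBot ∨ y = cubeTop
        · rw [cubeCoef_zero_right lam x y hy, zero_mul]
          exact Submodule.zero_mem _
        · simp [hy]⟩
      map_add' := fun v w => by
        apply Subtype.ext; simp [mul_add]
      map_smul' := fun c v => by
        apply Subtype.ext; simp; ring }
  map_refl x := by
    apply LinearMap.ext; intro v; apply Subtype.ext
    by_cases hx : x = cubeBot ∨ x = cubeTop
    · have hv0 : (v : K) = 0 := (Submodule.mem_bot K).1 ((SetLike.ext_iff.1 (if_pos hx) (v : K)).1 v.2)
      show cubeCoef lam x x * (v : K) = (v : K)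
      rw [hv0, mul_zero]
    · show cubeCoef lam x x * (v : K) = (v : K)
      rw [cubeCoef_self lam x hx, one_mul]
  map_trans {x y z} hxy hyz := by
    apply LinearMap.ext; intro v; apply Subtype.ext
    show cubeCoef lam x z * (v : K)
        = cubeCoef lam y z * (cubeCoef lam x y * (v : K))
    by_cases hv : (v : K) = 0
    · simp [hv]
    have hx : ¬(x = cubeBot ∨ x = cubeTop) := fun hx =>
      hv ((Submodule.mem_bot K).1 ((SetLike.ext_iff.1 (if_pos hx) (v : K)).1 v.2))
    by_cases hz : z = cubeBot ∨ z = cubeTop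
    · rw [cubeCoef_zero_right lam x z hz, cubeCoef_zero_right lam y z hz]
      ring
    by_cases hy : y = cubeBot ∨ y = cubeTop
    · exfalso
      rcases hy with hy | hy
      · subst hy
        exact hx (Or.inl (cube_le_bot x hxy))
      · subst hy
        exact hz (Or.inr (cube_top_le z hyz))
    have hkey : y = x ∨ y = z := cube_mid_between x y z hxy hyz hx hy hz
    rcases hkey with h | h
    · subst h
      rw [cubeCoef_self lam y hy]
      ring
    · subst h
      rw [cubeCoef_self lam y hy]
      ring

/-- The generator of `M(λ)` at the vertex `x`, which is zero at the two zero vertices. -/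
noncomputable def cubeGen (lam : K) (x : Cube) : (cubeRep K lam).V x :=
  (⟨if x = cubeBot ∨ x = cubeTop then 0 else 1, by
    by_cases h : x = cubeBot ∨ x = cubeTop
    · rw [if_pos h, if_pos h]
      exact Submodule.zero_mem (⊥ : Submodule K K)
    · rw [if_neg h, if_neg h]
      exact Submodule.mem_top⟩ :
    ↥(if x = cubeBot ∨ x = cubeTop then (⊥ : Submodule K K) else ⊤))

lemma exists_smul_cubeGen (lam : K) (x : Cube) (v : (cubeRep K lam).V x) :
    ∃ c : K, c • cubeGen lam x = v := by
  obtain ⟨v, hv⟩ : ↥(if x = cubeBot ∨ x = cubeTop then (⊥ : Submodule K K) else ⊤) := v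
  refine ⟨v, Subtype.ext ?_⟩
  change v * (if x = cubeBot ∨ x = cubeTop then (0 : K) else 1) = v
  by_cases h : x = cubeBot ∨ x = cubeTop
  · rw [if_pos h] at hv
    rw [(Submodule.mem_bot K).1 hv, zero_mul]
  · rw [if_neg h, mul_one]

lemma cubeRep_map_cubeGen (lam : K) {x y : Cube} (hxy : x ≤ y)
    (hx : ¬(x = cubeBot ∨ x = cubeTop)) (hy : ¬(y = cubeBot ∨ y = cubeTop)) :
    (cubeRep K lam).map hxy (cubeGen lam x) = cubeCoef lam x y • cubeGen lam y := by
  refine Subtype.ext ?_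
  change cubeCoef lam x y * (if x = cubeBot ∨ x = cubeTop then (0 : K) else 1)
    = cubeCoef lam x y * (if y = cubeBot ∨ y = cubeTop then (0 : K) else 1)
  rw [if_neg hx, if_neg hy]

lemma cubeGen_ne_zero (lam : K) {x : Cube} (hx : ¬(x = cubeBot ∨ x = cubeTop)) :
    cubeGen lam x ≠ 0 := by
  intro h
  have h' : (if x = cubeBot ∨ x = cubeTop then (0 : K) else 1) = 0 := congrArg Subtype.val h
  rw [if_neg hx] at h'
  exact one_ne_zero h'

lemma cubeGen_eq_zero (lam : K) {x : Cube} (hx : x = cubeBot ∨ x = cubeTop) :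
    cubeGen lam x = 0 :=
  Subtype.ext (if_pos hx)

lemma cubeCoef_eq_one (lam : K) {x y : Cube} (hx : ¬(x = cubeBot ∨ x = cubeTop))
    (hy : ¬(y = cubeBot ∨ y = cubeTop)) (h : ¬(x = cubeA ∧ y = cubeB)) :
    cubeCoef lam x y = 1 := by
  unfold cubeCoef
  rw [if_neg (by tauto), if_neg h]

lemma cubeCoef_cubeA_cubeB (lam : K) : cubeCoef lam cubeA cubeB = lam := by
  unfold cubeCoef
  rw [if_neg (by decide), if_pos ⟨rfl, rfl⟩]

/-- A property of vertices that is invariant along the five covering relations between nonzero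
vertices of the cube other than `(0,0,1) ≤ (0,1,1)` is constant on the nonzero vertices. -/
lemma cube_iff_of_invariant (p : Cube → Prop)
    (hp : ∀ x y : Cube, x ≤ y → ¬(x = cubeBot ∨ x = cubeTop) → ¬(y = cubeBot ∨ y = cubeTop) →
      ¬(x = cubeA ∧ y = cubeB) → (p x ↔ p y))
    (x : Cube) (hx : ¬(x = cubeBot ∨ x = cubeTop)) : p x ↔ p cubeA := by
  have h₁ := hp (0, 0, 1) (1, 0, 1) (by decide) (by decide) (by decide) (by decide)
  have h₂ := hp (1, 0, 0) (1, 0, 1) (by decide) (by decide) (by decide) (by decide)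
  have h₃ := hp (1, 0, 0) (1, 1, 0) (by decide) (by decide) (by decide) (by decide)
  have h₄ := hp (0, 1, 0) (1, 1, 0) (by decide) (by decide) (by decide) (by decide)
  have h₅ := hp (0, 1, 0) (0, 1, 1) (by decide) (by decide) (by decide) (by decide)
  have hcases : ∀ x : Cube, ¬(x = cubeBot ∨ x = cubeTop) →
      x = (0, 0, 1) ∨ x = (1, 0, 1) ∨ x = (1, 0, 0) ∨ x = (1, 1, 0) ∨ x = (0, 1, 0) ∨
        x = (0, 1, 1) := by decide
  change p x ↔ p (0, 0, 1)
  rcases hcases x hx with rfl | rfl | rfl | rfl | rfl | rfl <;> tauto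

lemma not_iso_intervalRep_cubeRep (lam : K) (hlam : lam ≠ 1) (I : Set Cube)
    (hI : IsConvexSet I) : ¬ (cubeRep K lam).Iso (intervalRep K I hI) := by
  rintro ⟨e, he⟩
  let c : Cube → K := fun x =>
    (e x (cubeGen lam x) : ↥(if x ∈ I then (⊤ : Submodule K K) else ⊥)).1
  have hc : ∀ x : Cube, ¬(x = cubeBot ∨ x = cubeTop) → c x ≠ 0 := fun x hx h =>
    cubeGen_ne_zero lam hx ((e x).map_eq_zero_iff.1 (Subtype.ext h))
  have hmem : ∀ x : Cube, ¬(x = cubeBot ∨ x = cubeTop) → x ∈ I := by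
    intro x hx
    by_contra h
    exact hc x hx ((Submodule.mem_bot K).1
      ((SetLike.ext_iff.1 (if_neg h) (c x)).1 (e x (cubeGen lam x)).2))
  have hmap : ∀ x y : Cube, x ≤ y → ¬(x = cubeBot ∨ x = cubeTop) →
      ¬(y = cubeBot ∨ y = cubeTop) → c x = cubeCoef lam x y * c y := by
    intro x y hxy hx hy
    have h := LinearMap.congr_fun (he x y hxy) (cubeGen lam x)
    simp only [LinearMap.comp_apply, LinearEquiv.coe_coe, cubeRep_map_cubeGen lam hxy hx hy,
      map_smul] at h
    have h' : (if y ∈ I then c x else 0) = cubeCoef lam x y * c y := congrArg Subtype.val h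
    rwa [if_pos (hmem y hy)] at h'
  have hBA : c cubeB = c cubeA :=
    (cube_iff_of_invariant (fun x => c x = c cubeA) (fun x y hxy hx hy hne => by
      rw [hmap x y hxy hx hy, cubeCoef_eq_one lam hx hy hne, one_mul]) cubeB (by decide)).2 rfl
  have hAB := hmap cubeA cubeB (by decide) (by decide) (by decide)
  rw [cubeCoef_cubeA_cubeB, hBA] at hAB
  exact hlam (mul_right_cancel₀ (hc cubeA (by decide)) (by rw [one_mul, ← hAB]))

lemma cubeRep_isThin (lam : K) : (cubeRep K lam).IsThin := fun x =>
  finrank_le_one (cubeGen lam x) (exists_smul_cubeGen lam x)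

lemma cubeRep_indecomposable (lam : K) : (cubeRep K lam).Indecomposable := by
  refine ⟨⟨cubeA, nontrivial_of_ne _ _ (cubeGen_ne_zero lam (by decide))⟩, ?_⟩
  rintro N₁ N₂ ⟨e, he⟩
  let a : ∀ x, N₁.V x := fun x => (e x (cubeGen lam x)).1
  let b : ∀ x, N₂.V x := fun x => (e x (cubeGen lam x)).2
  have hspan : ∀ x (n₁ : N₁.V x) (n₂ : N₂.V x), ∃ s : K, s • a x = n₁ ∧ s • b x = n₂ := by
    intro x n₁ n₂
    let n : (N₁.dsum N₂).V x := ((n₁, n₂) : N₁.V x × N₂.V x)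
    obtain ⟨s, hs⟩ := exists_smul_cubeGen lam x ((e x).symm n)
    have h : s • e x (cubeGen lam x) = n := by
      rw [← map_smul, hs, LinearEquiv.apply_symm_apply]
    exact ⟨s, congrArg Prod.fst h, congrArg Prod.snd h⟩
  have hsub₁ : ∀ x, a x = 0 → Subsingleton (N₁.V x) := fun x h =>
    subsingleton_of_forall_eq 0 fun n => by
      obtain ⟨s, hs, -⟩ := hspan x n 0
      rw [← hs, h, smul_zero]
  have hsub₂ : ∀ x, b x = 0 → Subsingleton (N₂.V x) := fun x h =>
    subsingleton_of_forall_eq 0 fun n => by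
      obtain ⟨s, -, hs⟩ := hspan x 0 n
      rw [← hs, h, smul_zero]
  have hor : ∀ x, a x = 0 ∨ b x = 0 := by
    intro x
    obtain ⟨s, hs, hs'⟩ := hspan x (a x) 0
    rcases smul_eq_zero.1 hs' with h | h
    · left
      rw [← hs, h, zero_smul]
    · exact Or.inr h
  have hnot : ∀ x, ¬(x = cubeBot ∨ x = cubeTop) → ¬(a x = 0 ∧ b x = 0) := fun x hx h =>
    cubeGen_ne_zero lam hx ((e x).map_eq_zero_iff.1 (Prod.ext h.1 h.2))
  have hzero : ∀ x, x = cubeBot ∨ x = cubeTop → a x = 0 ∧ b x = 0 := by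
    intro x hx
    have h : e x (cubeGen lam x) = 0 := by rw [cubeGen_eq_zero lam hx, map_zero]
    exact ⟨congrArg Prod.fst h, congrArg Prod.snd h⟩
  have hinv : ∀ x, ¬(x = cubeBot ∨ x = cubeTop) → (a x = 0 ↔ a cubeA = 0) := by
    refine cube_iff_of_invariant (fun x => a x = 0) fun x y hxy hx hy hne => ?_
    have h := LinearMap.congr_fun (he x y hxy) (cubeGen lam x)
    simp only [LinearMap.comp_apply, LinearEquiv.coe_coe, cubeRep_map_cubeGen lam hxy hx hy,
      cubeCoef_eq_one lam hx hy hne, one_smul] at h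
    have ha : N₁.map hxy (a x) = a y := congrArg Prod.fst h
    have hb : N₂.map hxy (b x) = b y := congrArg Prod.snd h
    have ha' : a x = 0 → a y = 0 := fun h => by rw [← ha, h, map_zero]
    have hb' : b x = 0 → b y = 0 := fun h => by rw [← hb, h, map_zero]
    have := hor x
    have := hnot y hy
    tauto
  rcases hor cubeA with hA | hA
  · refine Or.inl fun x => hsub₁ x ?_
    by_cases hx : x = cubeBot ∨ x = cubeTop
    · exact (hzero x hx).1
    · exact (hinv x hx).2 hA
  · refine Or.inr fun x => hsub₂ x ?_
    by_cases hx : x = cubeBot ∨ x = cubeTop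
    · exact (hzero x hx).2
    · exact (hor x).resolve_left fun h => hnot cubeA (by decide) ⟨(hinv x hx).1 h, hA⟩

/-- For `λ ≠ 1`, the representation `M(λ)` of the cube poset is
not isomorphic to any interval representation; in particular, over the
equioriented commutative 3D grid there exist thin indecomposable
representations that are not isomorphic to any interval representation. -/
theorem cubeRep_not_iso_interval (K : Type) [Field K] (lam : K)
    (hlam : lam ≠ 1) :
    (¬ ∃ (I : Set Cube) (hI : IsIntervalSet I),
        (cubeRep K lam).Iso (intervalRep K I hI.2.1)) ∧
    (∃ M : PRep K Cube, M.IsThin ∧ M.Indecomposable ∧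
        ¬ ∃ (I : Set Cube) (hI : IsIntervalSet I),
          M.Iso (intervalRep K I hI.2.1)) := by
  have hnot : ¬ ∃ (I : Set Cube) (hI : IsIntervalSet I),
      (cubeRep K lam).Iso (intervalRep K I hI.2.1) := fun ⟨I, hI, h⟩ =>
    not_iso_intervalRep_cubeRep lam hlam I hI.2.1 h
  exact ⟨hnot, cubeRep K lam, cubeRep_isThin lam, cubeRep_indecomposable lam, hnot⟩
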